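/- Let σ^α be an α-stable subordinator (α ∈ (0,1)) with E[e^{−λσ^α(t)}] = e^{−tλ^α}, L^α its inverse, and E an independent exponential random variable of rate θ. Then the waiting time J = σ^α(E) satisfies P(J > t) = E[e^{−θ L^α(t)}] = E_α(−θ t^α), where E_α is the Mittag-Leffler function E_α(x) = ∑_{k≥0} x^k/Γ(1+αk); consequently P(J > t) ~ t^{−α}/(θ Γ(1−α)) as t → ∞ and E[J] = ∞. -/

import Mathlib

open MeasureTheory Filter ProbabilityTheory

/-- The one-parameter Mittag-Leffler function `E_α(x) = ∑_{k ≥ 0} x^k / Γ(1 + αk)`. -/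
noncomputable def mittagLeffler (α x : ℝ) : ℝ := ∑' k : ℕ, x ^ k / Real.Gamma (1 + α * k)

lemma taub_cont {ι : Type*} (l : Filter ι) (f : ι → ℝ → ℝ) (g : ℝ → ℝ)
    (hfnn : ∀ i, ∀ x, 0 < x → 0 ≤ f i x)
    (hfint : ∀ i, IntegrableOn (fun x => Real.exp (-x) * f i x) (Set.Ioi 0))
    (hgint : IntegrableOn (fun x => Real.exp (-x) * g x) (Set.Ioi 0))
    (hlim : ∀ p : ℕ, Tendsto (fun i => ∫ x in Set.Ioi (0:ℝ), Real.exp (-((p+1)*x)) * f i x) l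
      (nhds (∫ x in Set.Ioi (0:ℝ), Real.exp (-((p+1)*x)) * g x)))
    (φ : ℝ → ℝ) (hφ : Continuous φ) :
    Tendsto (fun i => ∫ x in Set.Ioi (0:ℝ), φ (Real.exp (-x)) * (Real.exp (-x) * f i x)) l
      (nhds (∫ x in Set.Ioi (0:ℝ), φ (Real.exp (-x)) * (Real.exp (-x) * g x))) := by
  -- integrability against continuous functions
  have key : ∀ (h : ℝ → ℝ), IntegrableOn (fun x => Real.exp (-x) * h x) (Set.Ioi 0) →
      ∀ ψ : ℝ → ℝ, Continuous ψ →
      IntegrableOn (fun x => ψ (Real.exp (-x)) * (Real.exp (-x) * h x)) (Set.Ioi 0) := by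
    intro h hh ψ hψ
    obtain ⟨C, hC⟩ := (isCompact_Icc (a := (0:ℝ)) (b := 1)).exists_bound_of_continuousOn
      hψ.continuousOn
    refine Integrable.bdd_mul (c := C) hh ?_ ?_
    · exact (hψ.comp (Real.continuous_exp.comp continuous_neg)).aestronglyMeasurable
    · filter_upwards [ae_restrict_mem measurableSet_Ioi] with x hx
      apply hC
      refine ⟨(Real.exp_pos _).le, ?_⟩
      rw [Real.exp_le_one_iff]
      have : (0:ℝ) < x := hx
      linarith
  -- polynomials
  have hpoly : ∀ q : Polynomial ℝ,
      Tendsto (fun i => ∫ x in Set.Ioi (0:ℝ), q.eval (Real.exp (-x)) * (Real.exp (-x) * f i x)) l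
      (nhds (∫ x in Set.Ioi (0:ℝ), q.eval (Real.exp (-x)) * (Real.exp (-x) * g x))) := by
    intro q
    induction q using Polynomial.induction_on' with
    | add p q hp hq =>
      have e : ∀ h : ℝ → ℝ, IntegrableOn (fun x => Real.exp (-x) * h x) (Set.Ioi 0) →
          ∫ x in Set.Ioi (0:ℝ), (p+q).eval (Real.exp (-x)) * (Real.exp (-x) * h x) =
          (∫ x in Set.Ioi (0:ℝ), p.eval (Real.exp (-x)) * (Real.exp (-x) * h x)) +
          ∫ x in Set.Ioi (0:ℝ), q.eval (Real.exp (-x)) * (Real.exp (-x) * h x) := by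
        intro h hh
        rw [← integral_add (key h hh _ p.continuous) (key h hh _ q.continuous)]
        congr 1; ext x; rw [Polynomial.eval_add]; ring
      rw [e g hgint]
      simp_rw [fun i => e (f i) (hfint i)]
      exact hp.add hq
    | monomial n a =>
      have e : ∀ h : ℝ → ℝ,
          ∫ x in Set.Ioi (0:ℝ), (Polynomial.monomial n a).eval (Real.exp (-x)) * (Real.exp (-x) * h x) =
          a * ∫ x in Set.Ioi (0:ℝ), Real.exp (-((n+1)*x)) * h x := by
        intro h
        rw [← integral_const_mul]
        congr 1; ext x
        rw [Polynomial.eval_monomial, ← Real.exp_nat_mul]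
        have : Real.exp (-((n+1)*x)) = Real.exp (n * -x) * Real.exp (-x) := by
          rw [← Real.exp_add]; ring_nf
        rw [this]; ring
      simp_rw [e]
      exact (hlim n).const_mul a
  have h0 := hlim 0
  simp only [Nat.cast_zero, zero_add, one_mul] at h0
  obtain ⟨M, hM0, hM1, hM2⟩ : ∃ M : ℝ, 0 < M ∧
      (∫ x in Set.Ioi (0:ℝ), Real.exp (-x) * g x) < M ∧
      (∫ x in Set.Ioi (0:ℝ), ‖Real.exp (-x) * g x‖) < M := by
    refine ⟨max 0 (max (∫ x in Set.Ioi (0:ℝ), Real.exp (-x) * g x)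
      (∫ x in Set.Ioi (0:ℝ), ‖Real.exp (-x) * g x‖)) + 1, by positivity, ?_, ?_⟩
    · have := le_max_right 0 (max (∫ x in Set.Ioi (0:ℝ), Real.exp (-x) * g x)
        (∫ x in Set.Ioi (0:ℝ), ‖Real.exp (-x) * g x‖))
      have := le_max_left (∫ x in Set.Ioi (0:ℝ), Real.exp (-x) * g x)
        (∫ x in Set.Ioi (0:ℝ), ‖Real.exp (-x) * g x‖)
      linarith
    · have := le_max_right 0 (max (∫ x in Set.Ioi (0:ℝ), Real.exp (-x) * g x)
        (∫ x in Set.Ioi (0:ℝ), ‖Real.exp (-x) * g x‖))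
      have := le_max_right (∫ x in Set.Ioi (0:ℝ), Real.exp (-x) * g x)
        (∫ x in Set.Ioi (0:ℝ), ‖Real.exp (-x) * g x‖)
      linarith
  have hev : ∀ᶠ i in l, (∫ x in Set.Ioi (0:ℝ), ‖Real.exp (-x) * f i x‖) < M := by
    filter_upwards [h0.eventually_lt_const hM1] with i hi
    refine lt_of_eq_of_lt ?_ hi
    refine setIntegral_congr_fun measurableSet_Ioi fun x hx => ?_
    exact Real.norm_of_nonneg (mul_nonneg (Real.exp_pos _).le (hfnn i x hx))
  rw [Metric.tendsto_nhds]
  intro ε hε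
  obtain ⟨q, hq⟩ := exists_polynomial_near_of_continuousOn 0 1 φ hφ.continuousOn (ε / (4*M))
    (by positivity)
  have happ : ∀ h : ℝ → ℝ, IntegrableOn (fun x => Real.exp (-x) * h x) (Set.Ioi 0) →
      (∫ x in Set.Ioi (0:ℝ), ‖Real.exp (-x) * h x‖) < M →
      |(∫ x in Set.Ioi (0:ℝ), φ (Real.exp (-x)) * (Real.exp (-x) * h x)) -
      ∫ x in Set.Ioi (0:ℝ), q.eval (Real.exp (-x)) * (Real.exp (-x) * h x)| ≤ ε / 4 := by
    intro h hh hhM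
    rw [← integral_sub (key h hh _ hφ) (key h hh _ q.continuous), ← Real.norm_eq_abs]
    have : ‖∫ x in Set.Ioi (0:ℝ), (φ (Real.exp (-x)) * (Real.exp (-x) * h x) -
        q.eval (Real.exp (-x)) * (Real.exp (-x) * h x))‖ ≤
        ∫ x in Set.Ioi (0:ℝ), ε/(4*M) * ‖Real.exp (-x) * h x‖ := by
      refine norm_integral_le_of_norm_le (hh.norm.const_mul _) ?_
      filter_upwards [ae_restrict_mem measurableSet_Ioi] with x hx
      rw [← sub_mul, norm_mul]
      gcongr
      have := hq (Real.exp (-x)) ⟨(Real.exp_pos _).le, by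
        rw [Real.exp_le_one_iff]
        have : (0:ℝ) < x := hx
        linarith⟩
      rw [Real.norm_eq_abs, abs_sub_comm]; exact this.le
    refine this.trans ?_
    rw [integral_const_mul]
    calc ε/(4*M) * _ ≤ ε/(4*M) * M := by gcongr
      _ = ε / 4 := by field_simp
  have hp := Metric.tendsto_nhds.1 (hpoly q) (ε/4) (by positivity)
  filter_upwards [hev, hp] with i hi hpi
  have h1 := happ (f i) (hfint i) hi
  have h2 := happ g hgint hM2
  rw [Real.dist_eq] at *
  rw [abs_le] at h1 h2
  rw [abs_lt] at *
  constructor <;> linarith [h1.1, h1.2, h2.1, h2.2, hpi.1, hpi.2]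

lemma taub {ι : Type*} (l : Filter ι) (f : ι → ℝ → ℝ) (g : ℝ → ℝ)
    (hfnn : ∀ i, ∀ x, 0 < x → 0 ≤ f i x)
    (hfanti : ∀ i, AntitoneOn (f i) (Set.Ioi 0))
    (hfint : ∀ i, IntegrableOn (fun x => Real.exp (-x) * f i x) (Set.Ioi 0))
    (hgint : IntegrableOn (fun x => Real.exp (-x) * g x) (Set.Ioi 0))
    (hlim : ∀ p : ℕ, Tendsto (fun i => ∫ x in Set.Ioi (0:ℝ), Real.exp (-((p+1)*x)) * f i x) l
      (nhds (∫ x in Set.Ioi (0:ℝ), Real.exp (-((p+1)*x)) * g x)))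
    (x₀ : ℝ) (hx₀ : 0 < x₀) (hg : ContinuousAt g x₀) :
    Tendsto (fun i => f i x₀) l (nhds (g x₀)) := by
  have hcont := taub_cont l f g hfnn hfint hgint hlim
  -- bump functions
  have bump : ∀ a b : ℝ, 0 < a → a < b → ∃ φ : ℝ → ℝ, Continuous φ ∧ (∀ y, 0 ≤ φ y) ∧
      (∀ x, x ∉ Set.Ioo a b → φ (Real.exp (-x)) = 0) ∧
      IntegrableOn (fun x => φ (Real.exp (-x)) * Real.exp (-x)) (Set.Ioi 0) ∧
      0 < ∫ x in Set.Ioi (0:ℝ), φ (Real.exp (-x)) * Real.exp (-x) := by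
    intro a b ha hab
    set φ : ℝ → ℝ := fun y => max 0 (y - Real.exp (-b)) * max 0 (Real.exp (-a) - y) with hφ
    have hφc : Continuous φ := by fun_prop
    have hz : ∀ x, x ∉ Set.Ioo a b → φ (Real.exp (-x)) = 0 := by
      intro x hx
      simp only [hφ]
      by_cases h : x ≤ a
      · rw [max_eq_left (a := (0:ℝ)) (b := Real.exp (-a) - _), mul_zero]
        have := Real.exp_le_exp.2 (neg_le_neg h); linarith
      · have h' : b ≤ x := by
          by_contra hb; exact hx ⟨not_le.1 h, not_le.1 hb⟩
        rw [max_eq_left (a := (0:ℝ)) (b := _ - Real.exp (-b)), zero_mul]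
        have := Real.exp_le_exp.2 (neg_le_neg h'); linarith
    have hcc : Continuous fun x => φ (Real.exp (-x)) * Real.exp (-x) := by fun_prop
    have hsupp : HasCompactSupport fun x => φ (Real.exp (-x)) * Real.exp (-x) := by
      refine HasCompactSupport.intro (K := Set.Icc a b) isCompact_Icc ?_
      intro x hx
      rw [hz x (fun h => hx (Set.Ioo_subset_Icc_self h)), zero_mul]
    have hitg := hcc.integrable_of_hasCompactSupport (μ := volume) hsupp
    have hφnn : ∀ y, 0 ≤ φ y := fun y => mul_nonneg (le_max_left _ _) (le_max_left _ _)
    refine ⟨φ, hφc, hφnn, hz, hitg.integrableOn, ?_⟩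
    rw [setIntegral_pos_iff_support_of_nonneg_ae (ae_of_all _ fun x =>
      mul_nonneg (hφnn _) (Real.exp_pos _).le) hitg.integrableOn]
    have : Set.Ioo a b ⊆ (Function.support fun x => φ (Real.exp (-x)) * Real.exp (-x)) ∩ Set.Ioi 0 := by
      intro x hx
      refine ⟨?_, ha.trans hx.1⟩
      have h1 := Real.exp_lt_exp.2 (neg_lt_neg hx.1)
      have h2 := Real.exp_lt_exp.2 (neg_lt_neg hx.2)
      have : 0 < φ (Real.exp (-x)) :=
        mul_pos (lt_max_of_lt_right (by linarith)) (lt_max_of_lt_right (by linarith))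
      exact (mul_pos this (Real.exp_pos _)).ne'
    refine lt_of_lt_of_le ?_ (measure_mono this)
    simp [hab]
  have integ : ∀ (h : ℝ → ℝ), IntegrableOn (fun x => Real.exp (-x) * h x) (Set.Ioi 0) →
      ∀ ψ : ℝ → ℝ, Continuous ψ →
      IntegrableOn (fun x => ψ (Real.exp (-x)) * (Real.exp (-x) * h x)) (Set.Ioi 0) := by
    intro h hh ψ hψ
    obtain ⟨C, hC⟩ := (isCompact_Icc (a := (0:ℝ)) (b := 1)).exists_bound_of_continuousOn
      hψ.continuousOn
    refine Integrable.bdd_mul (c := C) hh ?_ ?_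
    · exact (hψ.comp (Real.continuous_exp.comp continuous_neg)).aestronglyMeasurable
    · filter_upwards [ae_restrict_mem measurableSet_Ioi] with x hx
      apply hC
      refine ⟨(Real.exp_pos _).le, ?_⟩
      rw [Real.exp_le_one_iff]
      have : (0:ℝ) < x := hx
      linarith
  -- comparison
  have cmp : ∀ (h : ℝ → ℝ), IntegrableOn (fun x => Real.exp (-x) * h x) (Set.Ioi 0) →
      ∀ a b c : ℝ, ∀ φ : ℝ → ℝ, Continuous φ → (∀ y, 0 ≤ φ y) →
      (∀ x, x ∉ Set.Ioo a b → φ (Real.exp (-x)) = 0) →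
      IntegrableOn (fun x => φ (Real.exp (-x)) * Real.exp (-x)) (Set.Ioi 0) →
      ((∀ x ∈ Set.Ioo a b, h x ≤ c) →
        (∫ x in Set.Ioi (0:ℝ), φ (Real.exp (-x)) * (Real.exp (-x) * h x)) ≤
          c * ∫ x in Set.Ioi (0:ℝ), φ (Real.exp (-x)) * Real.exp (-x)) ∧
      ((∀ x ∈ Set.Ioo a b, c ≤ h x) →
         c * (∫ x in Set.Ioi (0:ℝ), φ (Real.exp (-x)) * Real.exp (-x)) ≤
        (∫ x in Set.Ioi (0:ℝ), φ (Real.exp (-x)) * (Real.exp (-x) * h x))) := by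
    intro h hh a b c φ hφ hnn hz hi
    constructor
    · intro hc
      rw [← integral_const_mul]
      refine integral_mono (integ h hh φ hφ) (hi.const_mul c) fun x => ?_
      by_cases hx : x ∈ Set.Ioo a b
      · have := mul_le_mul_of_nonneg_left (hc x hx) (mul_nonneg (hnn (Real.exp (-x))) (Real.exp_pos (-x)).le)
        simp only; linarith
      · simp [hz x hx]
    · intro hc
      rw [← integral_const_mul]
      refine integral_mono (hi.const_mul c) (integ h hh φ hφ) fun x => ?_
      by_cases hx : x ∈ Set.Ioo a b
      · have := mul_le_mul_of_nonneg_left (hc x hx) (mul_nonneg (hnn (Real.exp (-x))) (Real.exp_pos (-x)).le)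
        simp only; linarith
      · simp [hz x hx]
  rw [Metric.tendsto_nhds]
  intro ε hε
  obtain ⟨δ, hδ, hgδ⟩ := Metric.continuousAt_iff.1 hg (ε/2) (by positivity)
  set d := min δ x₀ / 2 with hd
  have hd0 : 0 < d := by positivity
  have hdδ : d < δ := by have := min_le_left δ x₀; linarith
  have hdx : d < x₀ := by have := min_le_right δ x₀; linarith
  have hgb : ∀ x, x ∈ Set.Ioo (x₀ - d) (x₀ + d) → g x₀ - ε/2 ≤ g x ∧ g x ≤ g x₀ + ε/2 := by
    intro x hx
    have := hgδ (x := x) (by rw [Real.dist_eq, abs_lt]; constructor <;> linarith [hx.1, hx.2])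
    rw [Real.dist_eq, abs_lt] at this
    constructor <;> linarith
  have up : ∀ᶠ i in l, f i x₀ < g x₀ + ε := by
    obtain ⟨φ, hφ, hnn, hz, hi, hpos⟩ := bump (x₀ - d) x₀ (by linarith) (by linarith)
    have hG := (cmp g hgint (x₀ - d) x₀ (g x₀ + ε/2) φ hφ hnn hz hi).1
      (fun x hx => (hgb x ⟨hx.1, by linarith [hx.2]⟩).2)
    have : (∫ x in Set.Ioi (0:ℝ), φ (Real.exp (-x)) * (Real.exp (-x) * g x)) <
        (g x₀ + ε) * ∫ x in Set.Ioi (0:ℝ), φ (Real.exp (-x)) * Real.exp (-x) := by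
      refine hG.trans_lt ?_
      gcongr; linarith
    filter_upwards [(hcont φ hφ).eventually_lt_const this] with i hi'
    have hF := (cmp (f i) (hfint i) (x₀ - d) x₀ (f i x₀) φ hφ hnn hz hi).2
      (fun x hx => hfanti i (show x ∈ Set.Ioi 0 from lt_trans (by linarith) hx.1) hx₀ hx.2.le)
    exact lt_of_mul_lt_mul_right (hF.trans_lt hi') hpos.le
  have lo : ∀ᶠ i in l, g x₀ - ε < f i x₀ := by
    obtain ⟨φ, hφ, hnn, hz, hi, hpos⟩ := bump x₀ (x₀ + d) (by linarith) (by linarith)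
    have hG := (cmp g hgint x₀ (x₀ + d) (g x₀ - ε/2) φ hφ hnn hz hi).2
      (fun x hx => (hgb x ⟨by linarith [hx.1], hx.2⟩).1)
    have : (g x₀ - ε) * (∫ x in Set.Ioi (0:ℝ), φ (Real.exp (-x)) * Real.exp (-x)) <
        (∫ x in Set.Ioi (0:ℝ), φ (Real.exp (-x)) * (Real.exp (-x) * g x)) := by
      refine lt_of_lt_of_le ?_ hG
      gcongr; linarith
    filter_upwards [(hcont φ hφ).eventually_const_lt this] with i hi'
    have hF := (cmp (f i) (hfint i) x₀ (x₀ + d) (f i x₀) φ hφ hnn hz hi).1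
      (fun x hx => hfanti i hx₀ (show x ∈ Set.Ioi 0 from lt_trans hx₀ hx.1) hx.1.le)
    exact lt_of_mul_lt_mul_right (hi'.trans_le hF) hpos.le
  filter_upwards [up, lo] with i h1 h2
  rw [Real.dist_eq, abs_lt]; constructor <;> linarith

lemma gamma_lower (s A : ℝ) (hs : 0 ≤ s) (hA : 0 < A) :
    A ^ s * Real.exp (-A) ≤ Real.Gamma (1 + s) := by
  rw [Real.Gamma_eq_integral (by linarith), ← integral_exp_neg_Ioi, ← integral_const_mul]
  have hitg := Real.GammaIntegral_convergent (s := 1 + s) (by linarith)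
  calc ∫ x in Set.Ioi A, A ^ s * Real.exp (-x)
      ≤ ∫ x in Set.Ioi A, Real.exp (-x) * x ^ (1 + s - 1) := by
        refine setIntegral_mono_on ?_ ?_ measurableSet_Ioi ?_
        · have := integrableOn_exp_mul_Ioi (a := -1) (by norm_num) A
          simp only [neg_mul, one_mul] at this
          exact this.const_mul _
        · exact hitg.mono_set (Set.Ioi_subset_Ioi hA.le)
        · intro x hx
          rw [mul_comm, add_sub_cancel_left]
          gcongr
          exact le_of_lt hx
    _ ≤ _ := by
        refine setIntegral_mono_set hitg ?_ (Set.Ioi_subset_Ioi hA.le).eventuallyLE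
        filter_upwards [ae_restrict_mem measurableSet_Ioi] with x hx
        have : (0:ℝ) < x := hx
        simp only [Pi.zero_apply]; positivity

lemma ml_gamma_pos (α : ℝ) (hα : 0 < α) (k : ℕ) : 0 < Real.Gamma (1 + α * k) :=
  Real.Gamma_pos_of_pos (by positivity)

lemma ml_summable (α : ℝ) (hα : 0 < α) (R : ℝ) (hR : 0 ≤ R) :
    Summable fun k : ℕ => R ^ k / Real.Gamma (1 + α * k) := by
  set A := (R + 1) ^ (1/α) with hA
  have hA0 : 0 < A := by positivity
  have hAα : A ^ α = R + 1 := by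
    rw [hA, ← Real.rpow_mul (by linarith)]; field_simp; simp
  have hg : Summable fun k : ℕ => Real.exp A * (R / (R+1)) ^ k := by
    refine (summable_geometric_of_lt_one (by positivity) ?_).mul_left _
    rw [div_lt_one (by linarith)]; linarith
  refine Summable.of_nonneg_of_le (fun k => ?_) (fun k => ?_) hg
  · have := ml_gamma_pos α hα k; positivity
  · have h := gamma_lower (α * k) A (by positivity) hA0
    rw [Real.rpow_mul hA0.le, hAα, Real.rpow_natCast] at h
    calc R ^ k / Real.Gamma (1 + α * k) ≤ R ^ k / ((R+1)^k * Real.exp (-A)) := by gcongr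
      _ = _ := by rw [Real.exp_neg, div_pow]; field_simp

lemma ml_continuous (α : ℝ) (hα : 0 < α) : Continuous (mittagLeffler α) := by
  rw [continuous_iff_continuousAt]
  intro x
  have : ContinuousOn (mittagLeffler α) (Metric.closedBall 0 (|x| + 1)) := by
    unfold mittagLeffler
    refine continuousOn_tsum (u := fun k : ℕ => (|x| + 1) ^ k / Real.Gamma (1 + α * k)) ?_
      (ml_summable α hα _ (by positivity)) ?_
    · intro k; fun_prop
    · intro k y hy
      have hg := ml_gamma_pos α hα k
      rw [norm_div, norm_pow, Real.norm_of_nonneg hg.le]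
      gcongr
      simpa using hy
  refine this.continuousAt (Metric.closedBall_mem_nhds_of_mem ?_)
  simp

lemma ml_term (α : ℝ) (hα : 0 < α) (c p : ℝ) (hp : 0 < p) (k : ℕ) :
    IntegrableOn (fun x : ℝ => Real.exp (-(p*x)) * ((c * x ^ α) ^ k / Real.Gamma (1 + α * k)))
      (Set.Ioi 0) ∧
    ∫ x in Set.Ioi (0:ℝ), Real.exp (-(p*x)) * ((c * x ^ α) ^ k / Real.Gamma (1 + α * k)) =
      p⁻¹ * (c * p ^ (-α)) ^ k := by
  have hg := ml_gamma_pos α hα k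
  have e : Set.EqOn (fun x : ℝ => Real.exp (-(p*x)) * ((c * x ^ α) ^ k / Real.Gamma (1 + α * k)))
      (fun x => (c ^ k / Real.Gamma (1 + α * k)) * (x ^ ((1 + α * k) - 1) * Real.exp (-(p*x))))
      (Set.Ioi 0) := by
    intro x hx
    have hx : (0:ℝ) < x := hx
    simp only
    rw [mul_pow, ← Real.rpow_natCast (x ^ α), ← Real.rpow_mul hx.le, add_sub_cancel_left]
    ring
  constructor
  · refine IntegrableOn.congr_fun ?_ e.symm measurableSet_Ioi
    have := integrableOn_rpow_mul_exp_neg_mul_rpow (p := 1) (s := 1 + α * k - 1) (b := p)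
      (by have : 0 ≤ α * k := by positivity
          linarith) one_pos hp
    simp only [Real.rpow_one, neg_mul] at this
    exact this.const_mul _
  · rw [setIntegral_congr_fun measurableSet_Ioi e, integral_const_mul,
      Real.integral_rpow_mul_exp_neg_mul_Ioi (by positivity) hp, mul_pow, one_div,
      Real.inv_rpow hp.le, ← Real.rpow_neg hp.le, neg_add, Real.rpow_add hp,
      ← Real.rpow_natCast (p ^ (-α)), ← Real.rpow_mul hp.le, Real.rpow_neg_one, neg_mul]
    field_simp

lemma ml_laplace (α : ℝ) (hα : 0 < α) (c p : ℝ) (hc0 : 0 < c) (hc1 : c < 1) (hp : 1 ≤ p) :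
    IntegrableOn (fun x : ℝ => Real.exp (-(p*x)) * mittagLeffler α (-(c * x ^ α))) (Set.Ioi 0) ∧
    ∫ x in Set.Ioi (0:ℝ), Real.exp (-(p*x)) * mittagLeffler α (-(c * x ^ α)) =
      p⁻¹ * (1 + c * p ^ (-α))⁻¹ := by
  have hp0 : 0 < p := by linarith
  set F : ℕ → ℝ → ℝ := fun k x =>
    Real.exp (-(p*x)) * (((-c) * x ^ α) ^ k / Real.Gamma (1 + α * k)) with hF
  have hFs : ∀ x : ℝ, Real.exp (-(p*x)) * mittagLeffler α (-(c * x ^ α)) = ∑' k, F k x := by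
    intro x
    rw [hF, tsum_mul_left, mittagLeffler, neg_mul]
  simp_rw [hFs]
  have hFi : ∀ k, IntegrableOn (F k) (Set.Ioi 0) := fun k => (ml_term α hα (-c) p hp0 k).1
  have hcp : 0 ≤ c * p ^ (-α) := by positivity
  have hcp1 : c * p ^ (-α) < 1 := by
    have : p ^ (-α) ≤ 1 := Real.rpow_le_one_of_one_le_of_nonpos hp (by linarith)
    nlinarith [Real.rpow_pos_of_pos hp0 (-α)]
  have hFn : ∀ k, ∫ x in Set.Ioi (0:ℝ), ‖F k x‖ = p⁻¹ * (c * p ^ (-α)) ^ k := by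
    intro k
    rw [← (ml_term α hα c p hp0 k).2]
    refine setIntegral_congr_fun measurableSet_Ioi fun x hx => ?_
    have hx : (0:ℝ) < x := hx
    have := ml_gamma_pos α hα k
    simp only [hF]
    rw [norm_mul, norm_div, norm_pow, norm_mul, norm_neg, Real.norm_of_nonneg hc0.le,
      Real.norm_of_nonneg (Real.exp_pos _).le, Real.norm_of_nonneg this.le,
      Real.norm_of_nonneg (Real.rpow_pos_of_pos hx _).le]
  have hsum : Summable fun k => ∫ x in Set.Ioi (0:ℝ), ‖F k x‖ := by
    simp_rw [hFn]
    exact (summable_geometric_of_lt_one hcp hcp1).mul_left _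
  constructor
  · refine ⟨?_, ?_⟩
    · simp_rw [← hFs]
      refine Measurable.aestronglyMeasurable ?_
      refine Measurable.mul (by fun_prop) ?_
      exact (ml_continuous α hα).measurable.comp (by fun_prop)
    · have : ∀ x, ‖∑' k, F k x‖ₑ ≤ ∑' k, ‖F k x‖ₑ := fun x => enorm_tsum_le_tsum_enorm
      rw [HasFiniteIntegral]
      refine (lintegral_mono this).trans_lt ?_
      rw [lintegral_tsum (fun k => (hFi k).1.enorm)]
      have : ∀ k, ∫⁻ x in Set.Ioi (0:ℝ), ‖F k x‖ₑ = ENNReal.ofReal (∫ x in Set.Ioi (0:ℝ), ‖F k x‖) := by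
        intro k
        rw [ofReal_integral_norm_eq_lintegral_enorm (hFi k)]
      simp_rw [this]
      rw [← ENNReal.ofReal_tsum_of_nonneg (fun k => integral_nonneg fun _ => norm_nonneg _) hsum]
      exact ENNReal.ofReal_lt_top
  · have := hasSum_integral_of_summable_integral_norm hFi hsum
    refine this.unique ?_
    have e : ∀ k, ∫ x in Set.Ioi (0:ℝ), F k x = p⁻¹ * (-c * p ^ (-α)) ^ k :=
      fun k => (ml_term α hα (-c) p hp0 k).2
    simp_rw [e]
    have h := (hasSum_geometric_of_abs_lt_one (r := -c * p ^ (-α))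
      (by rw [neg_mul, abs_neg, abs_of_nonneg hcp]; exact hcp1)).mul_left p⁻¹
    simpa [neg_mul] using h

lemma S_int (S : ℝ → ℝ) (hS : Antitone S) (h0 : ∀ t, 0 ≤ S t) (h1 : ∀ t, S t ≤ 1) (r b : ℝ)
    (hr : 0 < r) :
    IntegrableOn (fun x => Real.exp (-(r * x)) * S (b * x)) (Set.Ioi 0) := by
  have hi : IntegrableOn (fun x => Real.exp (-(r * x))) (Set.Ioi 0) := by
    have := integrableOn_exp_mul_Ioi (a := -r) (by linarith) 0
    simpa only [neg_mul] using this
  refine Integrable.mul_bdd (c := 1) hi ?_ ?_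
  · exact (hS.measurable.comp (measurable_const_mul b)).aestronglyMeasurable
  · refine ae_of_all _ fun x => ?_
    rw [Real.norm_of_nonneg (h0 _)]; exact h1 _

lemma S_lap (α θ : ℝ) (S : ℝ → ℝ)
    (hlap : ∀ r : ℝ, 0 < r → ∫ t in Set.Ioi (0:ℝ), Real.exp (-(r * t)) * S t =
      r ^ (α - 1) / (θ + r ^ α)) (r b : ℝ) (hr : 0 < r) (hb : 0 < b) :
    ∫ x in Set.Ioi (0:ℝ), Real.exp (-(r * x)) * S (b * x) =
      b⁻¹ * ((r / b) ^ (α - 1) / (θ + (r / b) ^ α)) := by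
  rw [← hlap (r / b) (by positivity)]
  have := integral_comp_mul_left_Ioi (fun y => Real.exp (-(r / b * y)) * S y) 0 hb
  rw [mul_zero, smul_eq_mul] at this
  rw [← this]
  refine setIntegral_congr_fun measurableSet_Ioi fun x _ => ?_
  congr 3
  field_simp

lemma S_eq_ml (α θ : ℝ) (hα : 0 < α) (hθ : 0 < θ) (S : ℝ → ℝ) (hS : Antitone S)
    (h0 : ∀ t, 0 ≤ S t) (h1 : ∀ t, S t ≤ 1)
    (hlap : ∀ r : ℝ, 0 < r → ∫ t in Set.Ioi (0:ℝ), Real.exp (-(r * t)) * S t =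
      r ^ (α - 1) / (θ + r ^ α)) (t : ℝ) (ht : 0 < t) :
    S t = mittagLeffler α (-(θ * t ^ α)) := by
  -- scale so that the constant is 1/2
  set b : ℝ := (2 * θ) ^ (-(1/α)) with hb
  have hb0 : 0 < b := by positivity
  have hbα : b ^ α = 1 / (2 * θ) := by
    rw [hb, ← Real.rpow_mul (by positivity)]
    have : -(1 / α) * α = -1 := by field_simp
    rw [this, Real.rpow_neg_one, one_div]
  have hc := taub (⊤ : Filter Unit) (fun _ x => S (b * x))
    (fun x => mittagLeffler α (-(1/2 * x ^ α)))
    (fun _ x _ => h0 _)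
    (fun _ x hx y hy hxy => hS (by gcongr))
    (fun _ => by simpa using S_int S hS h0 h1 1 b one_pos)
    (by simpa using (ml_laplace α hα (1/2) 1 (by norm_num) (by norm_num) le_rfl).1)
    (fun p => by
      have hp : (0:ℝ) < (p:ℝ) + 1 := by positivity
      have hp1 : (1:ℝ) ≤ (p:ℝ) + 1 := by linarith [Nat.cast_nonneg (α := ℝ) p]
      simp only [S_lap α θ S hlap _ b hp hb0,
        (ml_laplace α hα (1/2) _ (by norm_num) (by norm_num) hp1).2]
      have : b⁻¹ * ((((p:ℝ)+1) / b) ^ (α - 1) / (θ + (((p:ℝ)+1) / b) ^ α)) =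
          ((p:ℝ)+1)⁻¹ * (1 + 1/2 * ((p:ℝ)+1) ^ (-α))⁻¹ := by
        rw [Real.rpow_sub_one (by positivity), Real.div_rpow hp.le hb0.le, hbα, Real.rpow_neg hp.le]
        have := Real.rpow_pos_of_pos hp α
        field_simp
        try ring
      rw [this]
      exact tendsto_const_nhds)
    (t / b) (by positivity)
    (by
      refine (ml_continuous α hα).continuousAt.comp ?_
      refine ContinuousAt.neg (ContinuousAt.mul continuousAt_const ?_)
      exact Real.continuousAt_rpow_const _ _ (Or.inl (by positivity)))
  have := tendsto_nhds_unique hc tendsto_const_nhds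
  rw [Real.div_rpow ht.le hb0.le, hbα, mul_div_cancel₀ _ hb0.ne'] at this
  rw [← this]
  congr 2
  field_simp

lemma S_tail (α θ : ℝ) (hα : 0 < α) (hα1 : α < 1) (hθ : 0 < θ) (S : ℝ → ℝ) (hS : Antitone S)
    (h0 : ∀ t, 0 ≤ S t) (h1 : ∀ t, S t ≤ 1)
    (hlap : ∀ r : ℝ, 0 < r → ∫ t in Set.Ioi (0:ℝ), Real.exp (-(r * t)) * S t =
      r ^ (α - 1) / (θ + r ^ α)) :
    Tendsto (fun t : ℝ => S t * (θ * Real.Gamma (1 - α) * t ^ α)) atTop (nhds 1) := by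
  have hG : 0 < Real.Gamma (1 - α) := Real.Gamma_pos_of_pos (by linarith)
  -- index by positive scale via `max t 1`
  have hm : ∀ t : ℝ, 0 < max t 1 := fun t => lt_max_of_lt_right one_pos
  have hmt : Tendsto (fun t : ℝ => max t 1) atTop atTop :=
    tendsto_atTop_mono (fun t => le_max_left _ _) tendsto_id
  have hpow : ∀ r : ℝ, 0 < r →
      IntegrableOn (fun x : ℝ => Real.exp (-(r*x)) * (x ^ (-α) / Real.Gamma (1-α))) (Set.Ioi 0) ∧
      ∫ x in Set.Ioi (0:ℝ), Real.exp (-(r*x)) * (x ^ (-α) / Real.Gamma (1-α)) = r ^ (α - 1) := by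
    intro r hr
    have e : (fun x : ℝ => Real.exp (-(r*x)) * (x ^ (-α) / Real.Gamma (1-α))) =
        fun x => (Real.Gamma (1-α))⁻¹ * (x ^ ((1 - α) - 1) * Real.exp (-(r * x))) := by
      ext x; rw [show (1 - α) - 1 = -α by ring]; ring
    rw [e]
    constructor
    · have := integrableOn_rpow_mul_exp_neg_mul_rpow (p := 1) (s := 1 - α - 1) (b := r)
        (by linarith) one_pos hr
      simp only [Real.rpow_one, neg_mul] at this
      exact this.const_mul _
    · rw [integral_const_mul, Real.integral_rpow_mul_exp_neg_mul_Ioi (by linarith) hr, one_div,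
        Real.inv_rpow hr.le, ← Real.rpow_neg hr.le, neg_sub]
      field_simp
  have hc := taub atTop (fun (t:ℝ) x => (θ * (max t 1) ^ α) * S (max t 1 * x))
    (fun x => x ^ (-α) / Real.Gamma (1 - α))
    (fun t x _ => mul_nonneg (mul_nonneg hθ.le (Real.rpow_nonneg (hm t).le _)) (h0 _))
    (fun t x hx y hy hxy => mul_le_mul_of_nonneg_left
      (hS (mul_le_mul_of_nonneg_left hxy (hm t).le))
      (mul_nonneg hθ.le (Real.rpow_nonneg (hm t).le _)))
    (fun t => by
      have := (S_int S hS h0 h1 1 (max t 1) one_pos).const_mul (θ * (max t 1) ^ α)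
      simp only [one_mul] at this
      refine this.congr (ae_of_all _ fun x => ?_)
      simp only; ring)
    (by simpa using (hpow 1 one_pos).1)
    (fun p => by
      have hp : (0:ℝ) < (p:ℝ) + 1 := by positivity
      rw [(hpow _ hp).2]
      have e : ∀ t : ℝ, ∫ x in Set.Ioi (0:ℝ), Real.exp (-(((p:ℝ)+1)*x)) *
          ((θ * (max t 1) ^ α) * S (max t 1 * x)) =
          θ * ((p:ℝ)+1) ^ (α - 1) / (θ + (((p:ℝ)+1) / max t 1) ^ α) := by
        intro t
        have e2 : (fun x : ℝ => Real.exp (-(((p:ℝ)+1)*x)) *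
          ((θ * (max t 1) ^ α) * S (max t 1 * x))) = fun x => (θ * (max t 1) ^ α) *
            (Real.exp (-(((p:ℝ)+1)*x)) * S (max t 1 * x)) := by
          ext x; ring
        have hb := hm t
        rw [e2, integral_const_mul, S_lap α θ S hlap _ _ hp (hm t)]
        generalize max t 1 = b at *
        rw [Real.div_rpow hp.le hb.le (α - 1), Real.rpow_sub_one hb.ne']
        have := Real.rpow_pos_of_pos hb α
        have : 0 < θ + (((p:ℝ)+1) / b) ^ α := by positivity
        field_simp
      simp_rw [e]
      have hz : Tendsto (fun t : ℝ => (((p:ℝ)+1) / max t 1) ^ α) atTop (nhds 0) := by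
        have := (hmt.const_div_atTop ((p:ℝ)+1)).rpow_const (p := α) (Or.inr hα.le)
        rwa [Real.zero_rpow hα.ne'] at this
      have := (tendsto_const_nhds (x := θ * ((p:ℝ)+1) ^ (α - 1))).div
        ((tendsto_const_nhds (x := θ)).add hz) (by simpa using hθ.ne')
      rw [add_zero, mul_div_cancel_left₀ _ hθ.ne'] at this
      exact this)
    1 one_pos
    (by
      refine ContinuousAt.div_const ?_ _
      exact Real.continuousAt_rpow_const _ _ (Or.inl one_ne_zero))
  have h2 := hc.mul_const (Real.Gamma (1 - α))
  rw [Real.one_rpow, one_div_mul_cancel hG.ne'] at h2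
  refine h2.congr' ?_
  filter_upwards [eventually_ge_atTop 1] with t ht
  rw [max_eq_left ht, mul_one]; ring

lemma lint_exp_Ioi (θ a : ℝ) (hθ : 0 < θ) :
    ∫⁻ s in Set.Ioi a, ENNReal.ofReal (θ * Real.exp (-(θ * s))) =
      ENNReal.ofReal (Real.exp (-(θ * a))) := by
  have hi : IntegrableOn (fun x => θ * Real.exp (-(θ * x))) (Set.Ioi a) := by
    have := integrableOn_exp_mul_Ioi (a := -θ) (by linarith) a
    simp only [neg_mul] at this
    exact this.const_mul _
  rw [← ofReal_integral_eq_lintegral_ofReal hi (ae_of_all _ fun x => by positivity),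
    integral_const_mul]
  have := integral_exp_mul_Ioi (a := -θ) (by linarith) a
  simp only [neg_mul] at this
  rw [this]
  congr 1
  field_simp

lemma lint_exp_lt (r x : ℝ) (hr : 0 < r) (hx : 0 ≤ x) :
    ∫⁻ t in Set.Ioi (0:ℝ), ENNReal.ofReal (Real.exp (-(r * t))) *
      (if t < x then 1 else 0) = ENNReal.ofReal ((1 - Real.exp (-(r * x))) / r) := by
  have hsub : Set.Ioo 0 x = Set.Iio x ∩ Set.Ioi 0 := by
    ext y; simp [and_comm]
  have e : (fun t : ℝ => ENNReal.ofReal (Real.exp (-(r * t))) * (if t < x then 1 else 0)) =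
      (Set.Iio x).indicator (fun t => ENNReal.ofReal (Real.exp (-(r * t)))) := by
    ext t
    by_cases h : t < x <;> simp [h]
  rw [e, lintegral_indicator measurableSet_Iio, Measure.restrict_restrict measurableSet_Iio,
    ← hsub, restrict_Ioo_eq_restrict_Ioc]
  have hc : Continuous fun t : ℝ => Real.exp (-(r * t)) := by fun_prop
  rw [← ofReal_integral_eq_lintegral_ofReal hc.integrableOn_Ioc
    (ae_of_all _ fun x => (Real.exp_pos _).le), ← intervalIntegral.integral_of_le hx]
  congr 1
  have hd : ∀ t ∈ Set.uIcc 0 x, HasDerivAt (fun t => -(Real.exp (-(r * t)) / r))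
      (Real.exp (-(r * t))) t := by
    intro t _
    have h1 : HasDerivAt (fun t : ℝ => -(r * t)) (-r) t := by
      have := (hasDerivAt_id' t).const_mul (-r)
      rw [mul_one] at this
      exact this.congr_of_eventuallyEq (Eventually.of_forall fun x => by simp)
    have h2 := (h1.exp.div_const r).fun_neg
    have e2 : -(Real.exp (-(r * t)) * -r / r) = Real.exp (-(r * t)) := by field_simp
    rwa [e2] at h2
  rw [intervalIntegral.integral_eq_sub_of_hasDerivAt hd (hc.intervalIntegrable _ _)]
  simp only [mul_zero, neg_zero, Real.exp_zero]
  ring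

lemma lint_final (α θ r : ℝ) (hθ : 0 < θ) (hr : 0 < r) :
    ∫⁻ s in Set.Ioi (0:ℝ), ENNReal.ofReal (θ * Real.exp (-(θ * s))) *
      ENNReal.ofReal ((1 - Real.exp (-(s * r ^ α))) / r) =
      ENNReal.ofReal (r ^ (α - 1) / (θ + r ^ α)) := by
  have hra : 0 < r ^ α := Real.rpow_pos_of_pos hr α
  have hi : ∀ c : ℝ, 0 < c → IntegrableOn (fun x => Real.exp (-(c * x))) (Set.Ioi 0) ∧
      ∫ x in Set.Ioi (0:ℝ), Real.exp (-(c * x)) = 1 / c := by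
    intro c hc
    have := integrableOn_exp_mul_Ioi (a := -c) (by linarith) 0
    have h2 := integral_exp_mul_Ioi (a := -c) (by linarith) 0
    simp only [neg_mul] at this h2
    refine ⟨this, ?_⟩
    rw [h2]; simp
  have h1 := hi θ hθ
  have h2 := hi (θ + r ^ α) (by positivity)
  have e : ∀ s : ℝ, ENNReal.ofReal (θ * Real.exp (-(θ * s))) *
      ENNReal.ofReal ((1 - Real.exp (-(s * r ^ α))) / r) =
      ENNReal.ofReal ((θ / r) * (Real.exp (-(θ * s)) - Real.exp (-((θ + r ^ α) * s)))) := by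
    intro s
    rw [← ENNReal.ofReal_mul (by positivity)]
    congr 1
    have : Real.exp (-((θ + r ^ α) * s)) = Real.exp (-(θ * s)) * Real.exp (-(s * r ^ α)) := by
      rw [← Real.exp_add]; ring_nf
    rw [this]; field_simp
  simp_rw [e]
  have h3 : IntegrableOn (fun s : ℝ => (θ / r) *
      (Real.exp (-(θ * s)) - Real.exp (-((θ + r ^ α) * s)))) (Set.Ioi 0) :=
    (h1.1.sub h2.1).const_mul _
  rw [← ofReal_integral_eq_lintegral_ofReal h3, integral_const_mul,
    integral_sub h1.1 h2.1, h1.2, h2.2, Real.rpow_sub_one hr.ne']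
  · congr 1
    field_simp
    ring
  · filter_upwards [ae_restrict_mem measurableSet_Ioi] with s hs
    have hs : (0:ℝ) < s := hs
    have : Real.exp (-((θ + r ^ α) * s)) ≤ Real.exp (-(θ * s)) := by
      apply Real.exp_le_exp.2
      nlinarith [mul_pos hra hs]
    simp only [Pi.zero_apply]
    exact mul_nonneg (by positivity) (by linarith)

section prob

variable {Ω : Type*} [MeasurableSpace Ω] (P : Measure Ω) [IsProbabilityMeasure P]

lemma ae_unbdd (α : ℝ) (σp : ℝ → Ω → ℝ)
    (hσmeas : Measurable fun p : ℝ × Ω => σp p.1 p.2)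
    (hσnonneg : ∀ t ω, 0 ≤ σp t ω)
    (hσlap : ∀ lam t : ℝ, 0 ≤ lam → 0 ≤ t →
      ∫ ω, Real.exp (-(lam * σp t ω)) ∂P = Real.exp (-(t * lam ^ α))) (t : ℝ) :
    ∀ᵐ ω ∂P, ∃ s, 0 < s ∧ t < σp s ω := by
  rw [ae_iff]
  have hb : ∀ n : ℕ, P.real {ω | ¬ ∃ s, 0 < s ∧ t < σp s ω} ≤ Real.exp t * Real.exp (-(n+1:ℝ)) := by
    intro n
    have hm : Measurable (σp (n+1)) := hσmeas.comp (measurable_const.prodMk measurable_id)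
    have hitg : Integrable (fun ω => Real.exp (-(1 * σp (n+1) ω))) P := by
      refine Integrable.of_bound (C := 1) (by fun_prop) (ae_of_all _ fun ω => ?_)
      rw [Real.norm_of_nonneg (Real.exp_pos _).le, Real.exp_le_one_iff]
      linarith [hσnonneg (n+1) ω]
    have h := mul_meas_ge_le_integral_of_nonneg (μ := P)
      (ae_of_all _ fun ω => (Real.exp_pos (-(1 * σp (n+1) ω))).le) hitg (Real.exp (-t))
    rw [hσlap 1 (n+1) zero_le_one (by positivity), Real.one_rpow, mul_one] at h
    have hsub : P.real {ω | ¬ ∃ s, 0 < s ∧ t < σp s ω} ≤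
        P.real {ω | Real.exp (-t) ≤ Real.exp (-(1 * σp (n+1) ω))} := by
      refine measureReal_mono ?_
      intro ω hω
      simp only [Set.mem_ofPred_eq, not_exists, not_and, not_lt] at hω
      have := hω (n+1) (by positivity)
      simp only [Set.mem_ofPred_eq, Real.exp_le_exp]
      linarith
    have h3 : Real.exp t * Real.exp (-t) = 1 := by rw [← Real.exp_add]; simp
    calc _ ≤ _ := hsub
      _ = Real.exp t * (Real.exp (-t) * P.real {ω | Real.exp (-t) ≤ Real.exp (-(1 * σp (n+1) ω))}) := by
        rw [← mul_assoc, h3, one_mul]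
      _ ≤ _ := by gcongr
  have hlim : Tendsto (fun n : ℕ => Real.exp t * Real.exp (-(n+1:ℝ))) atTop (nhds 0) := by
    have : Tendsto (fun n : ℕ => Real.exp (-(n+1:ℝ))) atTop (nhds 0) :=
      Real.tendsto_exp_neg_atTop_nhds_zero.comp
        (tendsto_atTop_add_const_right _ _ tendsto_natCast_atTop_atTop)
    simpa using this.const_mul (Real.exp t)
  have h0 : P.real {ω | ¬ ∃ s, 0 < s ∧ t < σp s ω} ≤ 0 := ge_of_tendsto' hlim hb
  have h0 := le_antisymm h0 measureReal_nonneg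
  rwa [measureReal_eq_zero_iff] at h0

/-- First passage functional, as a measurable functional on path space. -/
noncomputable def passG (t : ℝ) (f : ℝ → ℝ) : ℝ :=
  (⨅ q : ℚ, if 0 < q ∧ t < f q then ENNReal.ofReal q else ⊤).toReal

lemma passG_meas (t : ℝ) : Measurable (passG t) := by
  unfold passG
  refine Measurable.ennreal_toReal (Measurable.iInf fun q => ?_)
  refine Measurable.ite ?_ measurable_const measurable_const
  by_cases hq : 0 < q
  · simp only [hq, true_and]
    exact measurableSet_lt measurable_const (measurable_pi_apply _)
  · simp [hq]

lemma passG_eq (t : ℝ) (f : ℝ → ℝ) (hf : Monotone f) :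
    passG t f = sInf {s : ℝ | 0 < s ∧ t < f s} := by
  set A := {s : ℝ | 0 < s ∧ t < f s} with hA
  have hbdd : BddBelow A := ⟨0, fun s hs => hs.1.le⟩
  have hnn : 0 ≤ sInf A := Real.sInf_nonneg fun s hs => hs.1.le
  unfold passG
  by_cases hne : A.Nonempty
  · have : (⨅ q : ℚ, if 0 < q ∧ t < f q then ENNReal.ofReal q else ⊤) = ENNReal.ofReal (sInf A) := by
      apply le_antisymm
      · refine le_of_forall_gt fun c hc => ?_
        -- choose real then rational
        by_cases hct : c = ⊤
        · subst hct
          obtain ⟨s, hs⟩ := hne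
          obtain ⟨q, hq, -⟩ := exists_rat_btwn (lt_add_one s)
          refine (iInf_le _ q).trans_lt ?_
          have : 0 < q ∧ t < f q := ⟨by exact_mod_cast hs.1.trans hq, hs.2.trans_le (hf hq.le)⟩
          simp [this]
        · have hc' : sInf A < c.toReal := by
            rwa [← ENNReal.ofReal_lt_iff_lt_toReal hnn hct]
          obtain ⟨s, hs, hsc⟩ := exists_lt_of_csInf_lt hne hc'
          obtain ⟨q, hq, hqc⟩ := exists_rat_btwn hsc
          refine (iInf_le _ q).trans_lt ?_
          have : 0 < q ∧ t < f q := ⟨by exact_mod_cast hs.1.trans hq, hs.2.trans_le (hf hq.le)⟩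
          rw [if_pos this, ENNReal.ofReal_lt_iff_lt_toReal (hs.1.trans hq).le hct]
          exact hqc
      · refine le_iInf fun q => ?_
        split_ifs with h
        · exact ENNReal.ofReal_le_ofReal (csInf_le hbdd ⟨by exact_mod_cast h.1, h.2⟩)
        · exact le_top
    rw [this, ENNReal.toReal_ofReal hnn]
  · rw [Set.not_nonempty_iff_eq_empty] at hne
    have : ∀ q : ℚ, ¬ (0 < q ∧ t < f q) := by
      intro q hq
      have : (q:ℝ) ∈ A := ⟨by exact_mod_cast hq.1, hq.2⟩
      rw [hne] at this; exact this
    simp [this, hne]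

/-- `P(L < E) = E[exp(-θ L)] ≥ P(L ≤ E)`. -/
lemma exp_compare (E L : Ω → ℝ) (θ : ℝ) (hE : Measurable E) (hL : Measurable L)
    (hLnn : ∀ ω, 0 ≤ L ω)
    (hEexp : ∀ t : ℝ, 0 ≤ t → (P {ω | t < E ω}).toReal = Real.exp (-(θ * t)))
    (hind : IndepFun E L P) :
    P {ω | L ω < E ω} = ∫⁻ ω, ENNReal.ofReal (Real.exp (-(θ * L ω))) ∂P ∧
    P {ω | L ω ≤ E ω} ≤ ∫⁻ ω, ENNReal.ofReal (Real.exp (-(θ * L ω))) ∂P := by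
  have h1 : ∀ l : ℝ, 0 ≤ l → P {ω | l < E ω} = ENNReal.ofReal (Real.exp (-(θ * l))) := by
    intro l hl
    rw [← hEexp l hl, ENNReal.ofReal_toReal (measure_ne_top _ _)]
  have h2 : ∀ l : ℝ, 0 ≤ l → P {ω | l ≤ E ω} ≤ ENNReal.ofReal (Real.exp (-(θ * l))) := by
    intro l hl
    rcases hl.eq_or_lt with rfl | hl
    · simpa using prob_le_one
    · have hlim : Tendsto (fun d : ℝ => ENNReal.ofReal (Real.exp (-(θ * (l - d)))))
          (nhdsWithin 0 (Set.Ioi 0)) (nhds (ENNReal.ofReal (Real.exp (-(θ * l))))) := by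
        have : Continuous fun d : ℝ => ENNReal.ofReal (Real.exp (-(θ * (l - d)))) :=
          ENNReal.continuous_ofReal.comp (by fun_prop)
        have := this.tendsto 0
        rw [sub_zero] at this
        exact this.mono_left nhdsWithin_le_nhds
      refine ge_of_tendsto hlim ?_
      filter_upwards [Ioo_mem_nhdsGT hl] with d hd
      rw [← h1 (l - d) (by linarith [hd.2])]
      refine measure_mono fun ω hω => ?_
      have : l ≤ E ω := hω
      show l - d < E ω
      linarith [hd.1]
  have hmap : P.map (fun ω => (L ω, E ω)) = (P.map L).prod (P.map E) :=
    (indepFun_iff_map_prod_eq_prod_map_map hL.aemeasurable hE.aemeasurable).1 hind.symm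
  have := Measure.isProbabilityMeasure_map (μ := P) hE.aemeasurable
  constructor
  · have hs : MeasurableSet {p : ℝ × ℝ | p.1 < p.2} := measurableSet_lt measurable_fst measurable_snd
    calc P {ω | L ω < E ω} = P.map (fun ω => (L ω, E ω)) {p : ℝ × ℝ | p.1 < p.2} := by
          rw [Measure.map_apply (hL.prodMk hE) hs]; rfl
      _ = ∫⁻ ω, P.map E (Prod.mk (L ω) ⁻¹' {p : ℝ × ℝ | p.1 < p.2}) ∂P := by
          rw [hmap, Measure.prod_apply hs, lintegral_map (measurable_measure_prodMk_left hs) hL]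
      _ = _ := by
          refine lintegral_congr fun ω => ?_
          rw [Measure.map_apply hE (measurable_prodMk_left hs), ← h1 _ (hLnn ω)]; rfl
  · have hs : MeasurableSet {p : ℝ × ℝ | p.1 ≤ p.2} := measurableSet_le measurable_fst measurable_snd
    calc P {ω | L ω ≤ E ω} = P.map (fun ω => (L ω, E ω)) {p : ℝ × ℝ | p.1 ≤ p.2} := by
          rw [Measure.map_apply (hL.prodMk hE) hs]; rfl
      _ = ∫⁻ ω, P.map E (Prod.mk (L ω) ⁻¹' {p : ℝ × ℝ | p.1 ≤ p.2}) ∂P := by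
          rw [hmap, Measure.prod_apply hs, lintegral_map (measurable_measure_prodMk_left hs) hL]
      _ ≤ _ := by
          refine lintegral_mono fun ω => ?_
          rw [Measure.map_apply hE (measurable_prodMk_left hs)]
          exact h2 _ (hLnn ω)

/-- `exp(-θ L) = ∫ θ exp(-θ s) 1{t < f s} ds`. -/
lemma exp_L_eq (θ t : ℝ) (hθ : 0 < θ) (f : ℝ → ℝ) (hf : Monotone f)
    (hne : ∃ s, 0 < s ∧ t < f s) :
    ENNReal.ofReal (Real.exp (-(θ * sInf {s : ℝ | 0 < s ∧ t < f s}))) =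
      ∫⁻ s in Set.Ioi (0:ℝ), ENNReal.ofReal (θ * Real.exp (-(θ * s))) *
        (if t < f s then 1 else 0) := by
  set A := {s : ℝ | 0 < s ∧ t < f s} with hA
  have hbdd : BddBelow A := ⟨0, fun s hs => hs.1.le⟩
  have hnn : 0 ≤ sInf A := Real.sInf_nonneg fun s hs => hs.1.le
  rw [← lint_exp_Ioi θ (sInf A) hθ, ← Set.inter_eq_left.2 (Set.Ioi_subset_Ioi hnn),
    ← Measure.restrict_restrict measurableSet_Ioi, ← lintegral_indicator measurableSet_Ioi]
  refine lintegral_congr_ae ?_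
  have hne' : ∀ᵐ s ∂(volume.restrict (Set.Ioi (0:ℝ))), s ≠ sInf A :=
    ae_restrict_of_ae (by simp [ae_iff])
  filter_upwards [ae_restrict_mem measurableSet_Ioi, hne'] with s hs hsA
  by_cases h : t < f s
  · have : sInf A < s := lt_of_le_of_ne (csInf_le hbdd ⟨hs, h⟩) hsA.symm
    rw [Set.indicator_of_mem (show s ∈ Set.Ioi (sInf A) from this), if_pos h, mul_one]
  · have : ¬ sInf A < s := by
      intro hlt
      obtain ⟨u, hu, hus⟩ := exists_lt_of_csInf_lt hne hlt
      exact h (hu.2.trans_le (hf hus.le))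
    rw [Set.indicator_of_notMem (show s ∉ Set.Ioi (sInf A) from this), if_neg h, mul_zero]

end prob

/-- Let `σ^α` be an `α`-stable subordinator (`α ∈ (0,1)`, `E[e^{-λσ^α(t)}] = e^{-tλ^α}`),
`L^α(t) = inf{s > 0 : σ^α(s) > t}` its inverse, and `E` an independent exponential of rate `θ`.
Then `J = σ^α(E)` satisfies `P(J > t) = E[e^{-θ L^α(t)}] = E_α(-θ t^α)`; consequently
`P(J > t) ∼ t^{-α}/(θ Γ(1-α))` as `t → ∞`, and `E[J] = ∞`. -/
theorem mittag_leffler_waiting_time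
    {Ω : Type*} [MeasurableSpace Ω] (P : Measure Ω) [IsProbabilityMeasure P]
    (α : ℝ) (hα : α ∈ Set.Ioo (0:ℝ) 1)
    (σp : ℝ → Ω → ℝ) (E : Ω → ℝ) (θ : ℝ) (hθ : 0 < θ)
    (hσmeas : Measurable fun p : ℝ × Ω => σp p.1 p.2)
    (hσnonneg : ∀ t ω, 0 ≤ σp t ω)
    (hσ0 : ∀ ω, σp 0 ω = 0)
    (hσmono : ∀ ω, Monotone fun t => σp t ω)
    (hσrc : ∀ ω s, 0 ≤ s → ContinuousWithinAt (fun r => σp r ω) (Set.Ici s) s)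
    -- `σ^α` is an `α`-stable subordinator
    (hσlap : ∀ lam t : ℝ, 0 ≤ lam → 0 ≤ t →
      ∫ ω, Real.exp (-(lam * σp t ω)) ∂P = Real.exp (-(t * lam ^ α)))
    -- `E` is exponential of rate `θ`, independent of `σ^α`
    (hEmeas : Measurable E) (hEnonneg : ∀ ω, 0 ≤ E ω)
    (hEexp : ∀ t : ℝ, 0 ≤ t → (P {ω | t < E ω}).toReal = Real.exp (-(θ * t)))
    (hindep : IndepFun E (fun ω => fun t : ℝ => σp t ω) P) :
    -- survival function: `P(J > t) = E[e^{-θ L^α(t)}] = E_α(-θ t^α)`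
    (∀ t : ℝ, 0 < t →
      (P {ω | t < σp (E ω) ω}).toReal =
          ∫ ω, Real.exp (-(θ * sInf {s : ℝ | 0 < s ∧ t < σp s ω})) ∂P ∧
      (P {ω | t < σp (E ω) ω}).toReal = mittagLeffler α (-(θ * t ^ α))) ∧
    -- tail asymptotics `P(J > t) ∼ t^{-α}/(θ Γ(1-α))` as `t → ∞`
    Tendsto (fun t : ℝ =>
        (P {ω | t < σp (E ω) ω}).toReal * (θ * Real.Gamma (1 - α) * t ^ α))
      atTop (nhds 1) ∧
    -- infinite mean
    ∫⁻ ω, ENNReal.ofReal (σp (E ω) ω) ∂P = ⊤ := by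
  obtain ⟨hα0, hα1⟩ := hα
  have hJmeas : Measurable fun ω => σp (E ω) ω := hσmeas.comp (hEmeas.prodMk measurable_id)
  have hne := ae_unbdd P α σp hσmeas hσnonneg hσlap
  have hpath : Measurable fun ω => fun t : ℝ => σp t ω :=
    measurable_pi_lambda _ fun t => hσmeas.comp (measurable_const.prodMk measurable_id)
  have hLG : ∀ t, (fun ω => sInf {s : ℝ | 0 < s ∧ t < σp s ω}) =
      passG t ∘ (fun ω => fun t : ℝ => σp t ω) := by
    intro t; ext ω
    exact (passG_eq t _ (hσmono ω)).symm
  have hLmeas : ∀ t, Measurable fun ω => sInf {s : ℝ | 0 < s ∧ t < σp s ω} := by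
    intro t; rw [hLG]; exact (passG_meas t).comp hpath
  have hLind : ∀ t, IndepFun E (fun ω => sInf {s : ℝ | 0 < s ∧ t < σp s ω}) P := by
    intro t; rw [hLG]; exact hindep.comp measurable_id (passG_meas t)
  have hLnn : ∀ t ω, 0 ≤ sInf {s : ℝ | 0 < s ∧ t < σp s ω} :=
    fun t ω => Real.sInf_nonneg fun s hs => hs.1.le
  -- step 1
  have hS1 : ∀ t : ℝ, 0 < t → P {ω | t < σp (E ω) ω} =
      ∫⁻ ω, ENNReal.ofReal (Real.exp (-(θ * sInf {s : ℝ | 0 < s ∧ t < σp s ω}))) ∂P := by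
    intro t ht
    have hc := exp_compare P E _ θ hEmeas (hLmeas t) (hLnn t) hEexp (hLind t)
    apply le_antisymm
    · refine le_trans (measure_mono fun ω hω => ?_) hc.2
      have hω : t < σp (E ω) ω := hω
      have hE : 0 < E ω := by
        refine lt_of_le_of_ne (hEnonneg ω) fun h => ?_
        rw [← h, hσ0] at hω
        linarith
      have hb : BddBelow {s : ℝ | 0 < s ∧ t < σp s ω} := ⟨0, fun s hs => hs.1.le⟩
      exact csInf_le hb (show E ω ∈ {s : ℝ | 0 < s ∧ t < σp s ω} from ⟨hE, hω⟩)
    · rw [← hc.1]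
      refine measure_mono_ae ?_
      filter_upwards [hne t] with ω hω hlt
      obtain ⟨u, hu, hus⟩ := exists_lt_of_csInf_lt hω hlt
      exact hu.2.trans_le (hσmono ω hus.le)
  -- Laplace transform of the survival function
  have hlapE : ∀ r : ℝ, 0 < r → ∫⁻ t in Set.Ioi (0:ℝ), ENNReal.ofReal (Real.exp (-(r * t))) *
      P {ω | t < σp (E ω) ω} = ENNReal.ofReal (r ^ (α - 1) / (θ + r ^ α)) := by
    intro r hr
    have hmeas3 : Measurable fun p : ℝ × ℝ × Ω =>
        ENNReal.ofReal (Real.exp (-(r * p.1))) * (ENNReal.ofReal (θ * Real.exp (-(θ * p.2.1))) *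
          (if p.1 < σp p.2.1 p.2.2 then (1:ENNReal) else 0)) := by
      refine Measurable.mul (by fun_prop) (Measurable.mul (by fun_prop) ?_)
      exact Measurable.ite (measurableSet_lt measurable_fst (hσmeas.comp measurable_snd))
        measurable_const measurable_const
    have hmeas2 : ∀ t, Measurable fun p : Ω × ℝ => (ENNReal.ofReal (θ * Real.exp (-(θ * p.2))) *
          (if t < σp p.2 p.1 then (1:ENNReal) else 0)) := by
      intro t
      refine Measurable.mul (by fun_prop) ?_
      exact Measurable.ite (measurableSet_lt measurable_const
        (hσmeas.comp measurable_swap)) measurable_const measurable_const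
    have hmeas1 : ∀ s ω, Measurable fun t : ℝ => ENNReal.ofReal (Real.exp (-(r * t))) *
          (if t < σp s ω then (1:ENNReal) else 0) := by
      intro s ω
      refine Measurable.mul (by fun_prop) ?_
      exact Measurable.ite measurableSet_Iio measurable_const measurable_const
    calc ∫⁻ t in Set.Ioi (0:ℝ), ENNReal.ofReal (Real.exp (-(r * t))) * P {ω | t < σp (E ω) ω}
        = ∫⁻ t in Set.Ioi (0:ℝ), ∫⁻ s in Set.Ioi (0:ℝ), ∫⁻ ω,
            ENNReal.ofReal (Real.exp (-(r * t))) * (ENNReal.ofReal (θ * Real.exp (-(θ * s))) *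
          (if t < σp s ω then (1:ENNReal) else 0)) ∂P := by
          refine setLIntegral_congr_fun measurableSet_Ioi fun t ht => ?_
          have hQ : P {ω | t < σp (E ω) ω} = ∫⁻ s in Set.Ioi (0:ℝ), ∫⁻ ω,
              (ENNReal.ofReal (θ * Real.exp (-(θ * s))) *
                (if t < σp s ω then (1:ENNReal) else 0)) ∂P := by
            rw [hS1 t ht]
            refine Eq.trans (lintegral_congr_ae ?_)
              (lintegral_lintegral_swap (hmeas2 t).aemeasurable)
            filter_upwards [hne t] with ω hω
            exact exp_L_eq θ t hθ (fun s => σp s ω) (hσmono ω) hω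
          have hm2 : Measurable fun p : ℝ × Ω => (ENNReal.ofReal (θ * Real.exp (-(θ * p.1))) *
              (if t < σp p.1 p.2 then (1:ENNReal) else 0)) := (hmeas2 t).comp measurable_swap
          simp only [hQ]
          rw [← lintegral_const_mul _ hm2.lintegral_prod_right']
          refine lintegral_congr fun s => ?_
          exact (lintegral_const_mul _ (hm2.comp (measurable_prodMk_left (x := s)))).symm
      _ = ∫⁻ s in Set.Ioi (0:ℝ), ∫⁻ t in Set.Ioi (0:ℝ), ∫⁻ ω,
            ENNReal.ofReal (Real.exp (-(r * t))) * (ENNReal.ofReal (θ * Real.exp (-(θ * s))) *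
          (if t < σp s ω then (1:ENNReal) else 0)) ∂P := by
          refine lintegral_lintegral_swap ?_
          have h4 : Measurable fun q : (ℝ × ℝ) × Ω =>
              ENNReal.ofReal (Real.exp (-(r * q.1.1))) *
                (ENNReal.ofReal (θ * Real.exp (-(θ * q.1.2))) *
                (if q.1.1 < σp q.1.2 q.2 then (1:ENNReal) else 0)) :=
            hmeas3.comp (measurable_fst.fst.prodMk (measurable_fst.snd.prodMk measurable_snd))
          exact h4.lintegral_prod_right'.aemeasurable
      _ = ∫⁻ s in Set.Ioi (0:ℝ), ENNReal.ofReal (θ * Real.exp (-(θ * s))) *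
            ENNReal.ofReal ((1 - Real.exp (-(s * r ^ α))) / r) := by
          refine setLIntegral_congr_fun measurableSet_Ioi fun s hs => ?_
          have hs : (0:ℝ) < s := hs
          have hms : Measurable (σp s) := hσmeas.comp (measurable_const.prodMk measurable_id)
          have h4 : Measurable fun q : ℝ × Ω =>
              ENNReal.ofReal (Real.exp (-(r * q.1))) *
                (ENNReal.ofReal (θ * Real.exp (-(θ * s))) *
                (if q.1 < σp s q.2 then (1:ENNReal) else 0)) :=
            hmeas3.comp (measurable_fst.prodMk (measurable_const.prodMk measurable_snd))
          refine (lintegral_lintegral_swap h4.aemeasurable).trans ?_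
          have h5 : ∀ ω, ∫⁻ t in Set.Ioi (0:ℝ), ENNReal.ofReal (Real.exp (-(r * t))) *
                (ENNReal.ofReal (θ * Real.exp (-(θ * s))) *
                (if t < σp s ω then (1:ENNReal) else 0)) =
              ENNReal.ofReal (θ * Real.exp (-(θ * s))) *
                ENNReal.ofReal ((1 - Real.exp (-(r * σp s ω))) / r) := by
            intro ω
            rw [← lint_exp_lt r (σp s ω) hr (hσnonneg s ω), ← lintegral_const_mul _ (hmeas1 s ω)]
            refine lintegral_congr fun t => ?_
            ring
          simp_rw [h5]
          rw [lintegral_const_mul _ (by fun_prop)]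
          congr 1
          have hitg : Integrable (fun ω => Real.exp (-(r * σp s ω))) P := by
            refine Integrable.of_bound (C := 1) (by fun_prop) (ae_of_all _ fun ω => ?_)
            rw [Real.norm_of_nonneg (Real.exp_pos _).le, Real.exp_le_one_iff]
            have := mul_nonneg hr.le (hσnonneg s ω)
            linarith
          have hint2 : Integrable (fun ω => (1 - Real.exp (-(r * σp s ω))) / r) P :=
            ((integrable_const 1).sub hitg).div_const r
          rw [← ofReal_integral_eq_lintegral_ofReal hint2, integral_div,
            integral_sub (integrable_const 1) hitg, hσlap r s hr.le hs.le]
          · simp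
          · refine ae_of_all _ fun ω => ?_
            have : Real.exp (-(r * σp s ω)) ≤ 1 := by
              rw [Real.exp_le_one_iff]
              have := mul_nonneg hr.le (hσnonneg s ω)
              linarith
            exact div_nonneg (by linarith) hr.le
      _ = _ := lint_final α θ r hθ hr
  set S : ℝ → ℝ := fun t => (P {ω | t < σp (E ω) ω}).toReal with hSdef
  have hSanti : Antitone S := fun a b hab => ENNReal.toReal_mono (measure_ne_top _ _)
    (measure_mono fun ω hω => lt_of_le_of_lt hab hω)
  have hS0 : ∀ t, 0 ≤ S t := fun t => ENNReal.toReal_nonneg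
  have hS1' : ∀ t, S t ≤ 1 := fun t => measureReal_le_one
  have hlap : ∀ r : ℝ, 0 < r → ∫ t in Set.Ioi (0:ℝ), Real.exp (-(r * t)) * S t =
      r ^ (α - 1) / (θ + r ^ α) := by
    intro r hr
    rw [integral_eq_lintegral_of_nonneg_ae
      (ae_of_all _ fun t => mul_nonneg (Real.exp_pos _).le (hS0 t))
      (Measurable.aestronglyMeasurable (Measurable.mul (by fun_prop) hSanti.measurable))]
    have e : ∀ t, ENNReal.ofReal (Real.exp (-(r * t)) * S t) =
        ENNReal.ofReal (Real.exp (-(r * t))) * P {ω | t < σp (E ω) ω} := by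
      intro t
      rw [ENNReal.ofReal_mul (Real.exp_pos _).le, hSdef, ENNReal.ofReal_toReal (measure_ne_top _ _)]
    simp_rw [e]
    rw [hlapE r hr, ENNReal.toReal_ofReal (by positivity)]
  refine ⟨fun t ht => ⟨?_, ?_⟩, ?_, ?_⟩
  · rw [hS1 t ht, integral_eq_lintegral_of_nonneg_ae (ae_of_all _ fun ω => (Real.exp_pos _).le)]
    exact (Real.measurable_exp.comp ((hLmeas t).const_mul θ).neg).aestronglyMeasurable
  · exact S_eq_ml α θ hα0 hθ S hSanti hS0 hS1' hlap t ht
  · exact S_tail α θ hα0 hα1 hθ S hSanti hS0 hS1' hlap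
  · rw [lintegral_eq_lintegral_meas_lt P (ae_of_all _ fun ω => hσnonneg _ ω) hJmeas.aemeasurable]
    have hge : ∀ r : ℝ, 0 < r → ENNReal.ofReal (r ^ (α - 1) / (θ + r ^ α)) ≤
        ∫⁻ t in Set.Ioi (0:ℝ), P {ω | t < σp (E ω) ω} := by
      intro r hr
      rw [← hlapE r hr]
      refine setLIntegral_mono' measurableSet_Ioi fun t ht => ?_
      have ht : (0:ℝ) < t := ht
      refine mul_le_of_le_one_left' ?_
      rw [ENNReal.ofReal_le_one, Real.exp_le_one_iff]
      have := mul_pos hr ht; linarith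
    have hlim : Tendsto (fun r : ℝ => ENNReal.ofReal (r ^ (α - 1) / (θ + r ^ α)))
        (nhdsWithin 0 (Set.Ioi 0)) (nhds ⊤) := by
      refine ENNReal.tendsto_ofReal_atTop.comp ?_
      have h1 : Tendsto (fun r : ℝ => r ^ (α - 1)) (nhdsWithin 0 (Set.Ioi 0)) atTop :=
        tendsto_rpow_neg_nhdsGT_zero (by linarith)
      have h2 : Tendsto (fun r : ℝ => (θ + r ^ α)⁻¹) (nhdsWithin 0 (Set.Ioi 0)) (nhds θ⁻¹) := by
        have h3 : Tendsto (fun r : ℝ => r ^ α) (nhdsWithin 0 (Set.Ioi 0)) (nhds 0) := by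
          have := (Real.continuousAt_rpow_const 0 α (Or.inr hα0.le)).tendsto
          rw [Real.zero_rpow hα0.ne'] at this
          exact this.mono_left nhdsWithin_le_nhds
        have := ((tendsto_const_nhds (x := θ)).add h3).inv₀ (by simpa using hθ.ne')
        simpa using this
      exact h1.atTop_mul_pos (inv_pos.2 hθ) h2
    refine top_le_iff.1 (le_of_tendsto hlim ?_)
    filter_upwards [self_mem_nhdsWithin] with r hr
    exact hge r hr
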